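/- Let n ≥ 1, let P be a real symmetric n×n matrix with nonnegative entries and every row summing to 1 (so P is doubly stochastic), let λ ∈ (0,1], and suppose f ∈ ℝ^n lies in the span of eigenvectors of P whose eigenvalues μ satisfy |μ| ≥ λ. Then for every u ∈ ℝ^n with Σ_{i=1}^n u_i = 1 and every ℓ ∈ ℕ: |(1/n)·Σ_{i=1}^n f_i − Σ_{i=1}^n u_i f_i| ≤ (‖f‖₂/λ^ℓ) · (‖P^ℓ u‖₂² − 1/n)^{1/2}; in particular ‖P^ℓ u‖₂² ≥ 1/n, so the right-hand side is well defined. -/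

import Mathlib

open Matrix in
/-- For an eigenvector `b` of a symmetric matrix `P`, applying `P ^ ℓ` scales the `b`-coefficient
by the `ℓ`-th power of the eigenvalue. -/
lemma Matrix.IsSymm.dotProduct_pow_mulVec {ι : Type*} [Fintype ι] [DecidableEq ι]
    {P : Matrix ι ι ℝ} (hP : P.IsSymm) {b : ι → ℝ} {μ : ℝ} (hb : P *ᵥ b = μ • b)
    (w : ι → ℝ) (ℓ : ℕ) : b ⬝ᵥ (P ^ ℓ *ᵥ w) = μ ^ ℓ * (b ⬝ᵥ w) := by
  induction ℓ with
  | zero => simp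
  | succ k ih =>
    rw [pow_succ', ← mulVec_mulVec, dotProduct_mulVec, ← mulVec_transpose, hP.eq, hb,
      smul_dotProduct, ih, smul_eq_mul]
    ring

open Matrix in
/-- Eigenvectors with eigenvalue of absolute value less than `lam` are orthogonal to the span of
those with eigenvalue of absolute value at least `lam`. -/
lemma Matrix.IsSymm.dotProduct_eq_zero_of_mem_span {ι : Type*} [Fintype ι]
    {P : Matrix ι ι ℝ} (hP : P.IsSymm) {b : ι → ℝ} {ν lam : ℝ} (hb : P *ᵥ b = ν • b)
    (hν : |ν| < lam) {f : ι → ℝ}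
    (hf : f ∈ Submodule.span ℝ
        {v : ι → ℝ | v ≠ 0 ∧ ∃ μ : ℝ, lam ≤ |μ| ∧ P *ᵥ v = μ • v}) :
    b ⬝ᵥ f = 0 := by
  classical
  induction hf using Submodule.span_induction with
  | mem v hv =>
    obtain ⟨-, μ, hμ, hPv⟩ := hv
    have h := hP.dotProduct_pow_mulVec hb v 1
    rw [pow_one, pow_one, hPv, dotProduct_smul, smul_eq_mul] at h
    have hne : μ ≠ ν := by
      rintro rfl
      exact absurd hν hμ.not_gt
    by_contra hbv
    exact hne (mul_right_cancel₀ hbv h)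
  | zero => simp
  | add x y _ _ hx hy => rw [dotProduct_add, hx, hy, add_zero]
  | smul a x _ hx => rw [dotProduct_smul, hx, smul_zero]

open Matrix in
/-- Cauchy–Schwarz against a power of a symmetric matrix `P`, for `f` in the span of eigenvectors
with eigenvalues of absolute value at least `lam`. -/
lemma Matrix.IsSymm.pow_mul_abs_dotProduct_le {ι : Type*} [Fintype ι] [DecidableEq ι]
    {P : Matrix ι ι ℝ} (hP : P.IsSymm) {lam : ℝ} (hlam : 0 ≤ lam) {f : ι → ℝ}
    (hf : f ∈ Submodule.span ℝ
        {v : ι → ℝ | v ≠ 0 ∧ ∃ μ : ℝ, lam ≤ |μ| ∧ P *ᵥ v = μ • v})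
    (w : ι → ℝ) (ℓ : ℕ) :
    lam ^ ℓ * |f ⬝ᵥ w| ≤ √(∑ i, f i ^ 2) * √(∑ i, (P ^ ℓ *ᵥ w) i ^ 2) := by
  have hH : P.IsHermitian := isHermitian_iff_isSymm.2 hP
  let B := hH.eigenvectorBasis
  let b : ι → ι → ℝ := fun j => (B j).ofLp
  have hb : ∀ j, P *ᵥ b j = hH.eigenvalues j • b j := fun j => hH.mulVec_eigenvectorBasis j
  have hinner : ∀ x y : ι → ℝ, x ⬝ᵥ y = ∑ j, (b j ⬝ᵥ x) * (b j ⬝ᵥ y) := by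
    intro x y
    have h := B.sum_inner_mul_inner (WithLp.toLp 2 x) (WithLp.toLp 2 y)
    simp only [EuclideanSpace.inner_eq_star_dotProduct, star_trivial] at h
    rw [dotProduct_comm x y, ← h]
    refine Finset.sum_congr rfl fun j _ => ?_
    rw [dotProduct_comm y]
  have hsq : ∀ x : ι → ℝ, ∑ i, x i ^ 2 = ∑ j, |b j ⬝ᵥ x| ^ 2 := by
    intro x
    simpa [dotProduct, sq] using hinner x x
  rw [hsq f, hsq (P ^ ℓ *ᵥ w)]
  refine le_trans ?_ (Real.sum_mul_le_sqrt_mul_sqrt _ _ _)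
  rw [hinner f w]
  refine (mul_le_mul_of_nonneg_left (Finset.abs_sum_le_sum_abs _ _) (by positivity)).trans ?_
  rw [Finset.mul_sum]
  refine Finset.sum_le_sum fun j _ => ?_
  rw [hP.dotProduct_pow_mulVec (hb j), abs_mul, abs_mul, abs_pow, mul_left_comm]
  rcases lt_or_ge |hH.eigenvalues j| lam with hj | hj
  · simp [hP.dotProduct_eq_zero_of_mem_span (hb j) hj hf]
  · gcongr


/-- The paper's displayed bound (eq. 2, from Steinerberger): for a symmetric doubly
stochastic matrix `P`, `λ ∈ (0,1]`, and `f` in the span of eigenvectors of `P` with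
eigenvalues of absolute value `≥ λ`, every weight vector `u` with `Σ u_i = 1` satisfies
`‖P^ℓ u‖₂² ≥ 1/n` and
`|(1/n) Σ f_i - Σ u_i f_i| ≤ (‖f‖₂ / λ^ℓ) · (‖P^ℓ u‖₂² - 1/n)^(1/2)`. -/
theorem stmt7 (n : ℕ) (hn : 1 ≤ n) (P : Matrix (Fin n) (Fin n) ℝ)
    (hPsymm : P.IsSymm)
    (hPnonneg : ∀ i j, 0 ≤ P i j)
    (hProwsum : ∀ i, ∑ j, P i j = 1)
    (lam : ℝ) (hlam0 : 0 < lam) (hlam1 : lam ≤ 1)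
    (f : Fin n → ℝ)
    (hf : f ∈ Submodule.span ℝ
        {v : Fin n → ℝ | v ≠ 0 ∧ ∃ μ : ℝ, lam ≤ |μ| ∧ P.mulVec v = μ • v}) :
    ∀ u : Fin n → ℝ, (∑ i, u i = 1) → ∀ ℓ : ℕ,
      (1 / (n : ℝ) ≤ ∑ i, ((P ^ ℓ).mulVec u i) ^ 2) ∧
      |(1 / (n : ℝ)) * ∑ i, f i - ∑ i, u i * f i|
        ≤ (Real.sqrt (∑ i, f i ^ 2) / lam ^ ℓ) *
            Real.sqrt ((∑ i, ((P ^ ℓ).mulVec u i) ^ 2) - 1 / (n : ℝ)) := by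
  intro u hu ℓ
  have hn0 : (n : ℝ) ≠ 0 := by positivity
  have hone : P.mulVec 1 = (1 : ℝ) • (1 : Fin n → ℝ) := by
    ext i
    simp [Matrix.mulVec, dotProduct, hProwsum]
  have hsum : ∑ i, (P ^ ℓ).mulVec u i = 1 := by
    simpa [dotProduct, hu] using hPsymm.dotProduct_pow_mulVec hone u ℓ
  have hpow_one : (P ^ ℓ).mulVec 1 = 1 := by
    clear hsum
    induction ℓ with
    | zero => simp
    | succ k ih => rw [pow_succ', ← Matrix.mulVec_mulVec, ih, hone, one_smul]
  set w : Fin n → ℝ := (1 / (n : ℝ)) • 1 - u with hw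
  have hvar : ∑ i, ((P ^ ℓ).mulVec w i) ^ 2 =
      ∑ i, ((P ^ ℓ).mulVec u i) ^ 2 - 1 / (n : ℝ) := by
    have hterm : ∀ i, ((P ^ ℓ).mulVec w i) ^ 2 = (1 / (n : ℝ)) ^ 2
        - 2 * (1 / (n : ℝ)) * (P ^ ℓ).mulVec u i + ((P ^ ℓ).mulVec u i) ^ 2 := by
      intro i
      rw [hw, Matrix.mulVec_sub, Matrix.mulVec_smul, hpow_one]
      simp only [Pi.sub_apply, Pi.smul_apply, Pi.one_apply, smul_eq_mul]
      ring
    simp only [hterm, Finset.sum_add_distrib, Finset.sum_sub_distrib, ← Finset.mul_sum, hsum,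
      Finset.sum_const, Finset.card_univ, Fintype.card_fin, nsmul_eq_mul]
    field_simp
    ring
  have hdot : dotProduct f w = (1 / (n : ℝ)) * ∑ i, f i - ∑ i, u i * f i := by
    rw [hw, dotProduct_sub, dotProduct_smul, dotProduct_one, smul_eq_mul, dotProduct_comm f u]
    rfl
  refine ⟨sub_nonneg.1 (hvar ▸ Finset.sum_nonneg fun i _ => sq_nonneg _), ?_⟩
  rw [← hvar, ← hdot, div_mul_eq_mul_div, le_div_iff₀ (by positivity), mul_comm]
  exact hPsymm.pow_mul_abs_dotProduct_le hlam0.le hf w ℓ
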